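/- arXiv:2310.11610 — 2 statements merged into one kernel-verified Lean document; each statement's English description precedes it below -/
import Mathlib

section
/- Let n ≥ 2 and p ∈ (1,n]. Let F : ℝ^n → ℝ be positively homogeneous of degree one, symmetric under permutations of coordinates, concave (so that Γ = {λ ∈ ℝ^n : F(λ) ≥ 0} is a convex cone), differentiable at the point v = (−(n−1)/(p−1), 1, 1, …, 1) with F(v) = 0 and ∂F/∂λ_1(v) > 0. Then Γ ⊆ 𝒜^{(p)}, and for every q > p one has Γ ⊄ 𝒜^{(q)}; consequently p = max{q : Γ ⊆ 𝒜^{(q)}}. -/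
open MeasureTheory Filter Metric Set
open scoped Topology ENNReal RealInnerProductSpace Classical

noncomputable section

/-- Euclidean space `ℝ^n`. -/
abbrev Euc (n : ℕ) : Type := EuclideanSpace ℝ (Fin n)

/-- The Wolff potential `W^μ_{1,p}(x,r) = ∫_0^r (μ(B(x,t))/t^{n-p})^{1/(p-1)} dt/t`. -/
noncomputable def wolff (n : ℕ) (μ : Measure (Euc n)) (p : ℝ) (x : Euc n) (r : ℝ) : ℝ :=
  ∫ t in Set.Ioo (0 : ℝ) r, ((μ (Metric.ball x t)).toReal / t ^ ((n : ℝ) - p)) ^ (1 / (p - 1)) / t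

/-- The variational `p`-capacity of a compact set `K` in `Ω`:
`inf {∫_Ω |∇u|^p : u ∈ C_c^∞(Ω), u ≥ 1 on K}`. -/
noncomputable def pCapK (n : ℕ) (p : ℝ) (K Ω : Set (Euc n)) : ℝ :=
  sInf {c : ℝ | ∃ u : Euc n → ℝ, ContDiff ℝ (⊤ : ℕ∞) u ∧ HasCompactSupport u ∧ tsupport u ⊆ Ω ∧
    (∀ x ∈ K, 1 ≤ u x) ∧ c = ∫ x in Ω, ‖gradient u x‖ ^ p}

/-- The `p`-capacity of an arbitrary set `S ⊆ Ω`: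
`inf_{S ⊆ G ⊆ Ω open} sup_{K ⊆ G compact} cap_p(K, Ω)`. -/
noncomputable def pCap (n : ℕ) (p : ℝ) (S Ω : Set (Euc n)) : ℝ :=
  sInf {c : ℝ | ∃ G : Set (Euc n), IsOpen G ∧ S ⊆ G ∧ G ⊆ Ω ∧
    c = sSup {d : ℝ | ∃ K : Set (Euc n), IsCompact K ∧ K ⊆ G ∧ d = pCapK n p K Ω}}

/-- The annulus `ω_i(x0) = {x : 2^{-i-1} ≤ |x - x0| ≤ 2^{-i}}`. -/
def annS (n : ℕ) (x0 : Euc n) (i : ℕ) : Set (Euc n) :=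
  {x | (2 : ℝ) ^ (-(i : ℝ) - 1) ≤ ‖x - x0‖ ∧ ‖x - x0‖ ≤ (2 : ℝ) ^ (-(i : ℝ))}

/-- The annulus `Ω_i(x0) = {x : 2^{-i-2} ≤ |x - x0| ≤ 2^{-i+1}}`. -/
def annB (n : ℕ) (x0 : Euc n) (i : ℕ) : Set (Euc n) :=
  {x | (2 : ℝ) ^ (-(i : ℝ) - 2) ≤ ‖x - x0‖ ∧ ‖x - x0‖ ≤ (2 : ℝ) ^ (-(i : ℝ) + 1)}

/-- `S` is `p`-thin for the singular behavior at `x0` (case `1 < p < n`):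
`Σ_{i=1}^∞ 2^{i(n-p)} cap_p(S ∩ ω_i(x0), Ω_i(x0)) < ∞`. -/
def PThinSingular (n : ℕ) (p : ℝ) (S : Set (Euc n)) (x0 : Euc n) : Prop :=
  Summable (fun i : ℕ =>
    (2 : ℝ) ^ (((i : ℝ) + 1) * ((n : ℝ) - p)) *
      pCap n p (S ∩ annS n x0 (i + 1)) (annB n x0 (i + 1)))

/-- `S` is `n`-thin for the singular behavior at `x0`:
`Σ_{i=1}^∞ i^{n-1} cap_n(S ∩ ω_i(x0), Ω_i(x0)) < ∞`. -/
def NThinSingular (n : ℕ) (S : Set (Euc n)) (x0 : Euc n) : Prop :=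
  Summable (fun i : ℕ =>
    ((i : ℝ) + 1) ^ ((n : ℝ) - 1) *
      pCap n (n : ℝ) (S ∩ annS n x0 (i + 1)) (annB n x0 (i + 1)))

/-- `h` is `p`-harmonic in `D`: a continuous weak solution of `div(|∇h|^{p-2}∇h) = 0`. -/
def IsPHarmonic (n : ℕ) (p : ℝ) (D : Set (Euc n)) (h : Euc n → ℝ) : Prop :=
  ContinuousOn h D ∧
  ∀ φ : Euc n → ℝ, ContDiff ℝ (⊤ : ℕ∞) φ → HasCompactSupport φ → tsupport φ ⊆ D →
    ∫ x in D, ‖gradient h x‖ ^ (p - 2) * ⟪gradient h x, gradient φ x⟫ = 0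

/-- `v : Ω → (-∞, ∞]` is `p`-superharmonic in `Ω`: lower semicontinuous, not identically `∞`,
and satisfying the comparison principle against `p`-harmonic functions on subdomains. -/
def IsPSuperharmonic (n : ℕ) (p : ℝ) (Ω : Set (Euc n)) (v : Euc n → EReal) : Prop :=
  LowerSemicontinuousOn v Ω ∧ (∃ x ∈ Ω, v x ≠ ⊤) ∧
  ∀ D : Set (Euc n), IsOpen D → IsConnected D → IsCompact (closure D) → closure D ⊆ Ω →
    ∀ h : Euc n → ℝ, ContinuousOn h (closure D) → IsPHarmonic n p D h →
      (∀ x ∈ frontier D, (h x : EReal) ≤ v x) → ∀ x ∈ D, (h x : EReal) ≤ v x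

/-- The truncation `min(u, λ)` of an `EReal`-valued function, as a real-valued function. -/
noncomputable def trunc (n : ℕ) (u : Euc n → EReal) (lam : ℝ) (x : Euc n) : ℝ :=
  (min (u x) (lam : EReal)).toReal

/-- `μ` is the Riesz measure of the `p`-superharmonic function `u` on `Ω`, i.e. `-Δ_p u = μ`
weakly, where `g` is the a.e.-defined gradient of `u` obtained from the truncations
`min(u, λ)`. -/
def IsRieszMeasureOf (n : ℕ) (p : ℝ) (Ω : Set (Euc n)) (u : Euc n → EReal)
    (g : Euc n → Euc n) (μ : Measure (Euc n)) : Prop :=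
  (∀ lam : ℝ, ∀ᵐ x ∂(volume.restrict Ω),
      u x < (lam : EReal) → HasGradientAt (trunc n u lam) (g x) x) ∧
  ∀ φ : Euc n → ℝ, ContDiff ℝ (⊤ : ℕ∞) φ → HasCompactSupport φ → tsupport φ ⊆ Ω →
    ∫ x in Ω, ‖g x‖ ^ (p - 2) * ⟪g x, gradient φ x⟫ = ∫ x, φ x ∂μ

/-- The surface measure `|𝕊^{n-1}|` of the unit sphere in `ℝ^n`. -/
noncomputable def sphereSurface (n : ℕ) : ℝ :=
  (n : ℝ) * (volume (Metric.ball (0 : Euc n) 1)).toReal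

/-- The Hessian `D²u(x)` of `u` at `x`, as a bilinear form. -/
noncomputable def hess (n : ℕ) (u : Euc n → ℝ) (x v w : Euc n) : ℝ :=
  fderiv ℝ (fderiv ℝ u) x v w

/-- The cone `𝒜^{(p)} = {λ ∈ ℝ^n : (p-1)λ_i + Σ_{j≠i} λ_j ≥ 0 for all i}`. -/
def Acone (n : ℕ) (p : ℝ) : Set (Fin n → ℝ) :=
  {lam | ∀ i, 0 ≤ (p - 1) * lam i + ∑ j ∈ Finset.univ.erase i, lam j}

/-- The `k`-th elementary symmetric function `σ_k` of `v ∈ ℝ^n`. -/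
def esymm (n k : ℕ) (v : Fin n → ℝ) : ℝ :=
  ∑ s ∈ Finset.powersetCard k (Finset.univ : Finset (Fin n)), ∏ i ∈ s, v i

/-- The cone `Γ^k = {λ ∈ ℝ^n : σ_1(λ) ≥ 0, σ_2(λ) ≥ 0, …, σ_k(λ) ≥ 0}`. -/
def GammaK (n k : ℕ) : Set (Fin n → ℝ) :=
  {lam | ∀ l : ℕ, 1 ≤ l → l ≤ k → 0 ≤ esymm n l lam}

/-- `p`-thinness for the singular behavior, covering both cases `p < n` and `p = n`. -/
def ThinSingular (n : ℕ) (p : ℝ) (S : Set (Euc n)) (x0 : Euc n) : Prop :=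
  (p < (n : ℝ) → PThinSingular n p S x0) ∧ (p = (n : ℝ) → NThinSingular n S x0)

/-- `𝒢^k(x, x0)`: equal to `|x-x0|^{2-n/k}` when `2k < n` and `-log |x-x0|` when `2k = n`. -/
noncomputable def GkFun (n k : ℕ) (x0 x : Euc n) : ℝ :=
  if 2 * k < n then ‖x - x0‖ ^ (2 - (n : ℝ) / (k : ℝ)) else -Real.log ‖x - x0‖

/-- The fundamental solution `G_p` of the `p`-Laplacian. -/
noncomputable def Gfun (n : ℕ) (p : ℝ) (x : Euc n) : ℝ :=
  if p < n then ‖x‖ ^ (-(((n : ℝ) - p) / (p - 1))) else -Real.log ‖x‖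

/-- The normalizing constant `α₀(n,p)`. -/
noncomputable def alpha0 (n : ℕ) (p : ℝ) : ℝ :=
  if p < n then (((n : ℝ) - p) / (p - 1)) ^ (p - 1) * sphereSurface n else sphereSurface n

/-- Supergradient inequality for positively homogeneous concave functions. -/
lemma ConcaveOn.le_fderiv_of_posHom {E : Type*} [NormedAddCommGroup E] [NormedSpace ℝ E]
    {F : E → ℝ} (hhom : ∀ t : ℝ, 0 < t → ∀ x, F (t • x) = t * F x)
    (hconc : ConcaveOn ℝ Set.univ F) {v : E} (hdiff : DifferentiableAt ℝ F v) (x : E) :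
    F x ≤ fderiv ℝ F v x := by
  have hsuper (y z : E) : F y + F z ≤ F (y + z) := by
    have h := hconc.2 (Set.mem_univ y) (Set.mem_univ z) (one_half_pos (α := ℝ)).le
      (one_half_pos (α := ℝ)).le (add_halves 1)
    rw [← smul_add, ← smul_add, hhom _ one_half_pos] at h
    simp only [smul_eq_mul] at h
    linarith
  have hd : HasDerivAt (fun t : ℝ => F (v + t • x)) (fderiv ℝ F v x) 0 :=
    hdiff.hasFDerivAt.hasLineDerivAt x
  refine ge_of_tendsto hd.tendsto_slope_zero_right ?_
  filter_upwards [self_mem_nhdsWithin] with t ht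
  have ht : 0 < t := ht
  have h := hsuper v (t • x)
  rw [hhom t ht] at h
  simp only [zero_add, zero_smul, add_zero, smul_eq_mul]
  rw [inv_mul_eq_div, le_div_iff₀ ht]
  linarith

/-- Euler's identity at a zero of a positively homogeneous function. -/
lemma fderiv_self_eq_zero_of_posHom {E : Type*} [NormedAddCommGroup E] [NormedSpace ℝ E]
    {F : E → ℝ} (hhom : ∀ t : ℝ, 0 < t → ∀ x, F (t • x) = t * F x)
    {v : E} (hdiff : DifferentiableAt ℝ F v) (h0 : F v = 0) :
    fderiv ℝ F v v = 0 := by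
  have hd : HasDerivAt (fun t : ℝ => F (v + t • v)) (fderiv ℝ F v v) 0 :=
    hdiff.hasFDerivAt.hasLineDerivAt v
  refine hd.unique ((hasDerivAt_const (0 : ℝ) (0 : ℝ)).congr_of_eventuallyEq ?_)
  filter_upwards [lt_mem_nhds (show (-1 : ℝ) < 0 by norm_num)] with t ht
  have h : v + t • v = (1 + t) • v := by rw [add_smul, one_smul]
  rw [h, hhom _ (by linarith), h0, mul_zero]

/-- The derivative of a symmetric function at `v` is invariant under permutations fixing `v`. -/
lemma fderiv_comp_perm_of_symm {ι : Type*} [Fintype ι] {F : (ι → ℝ) → ℝ}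
    (hsymm : ∀ σ : Equiv.Perm ι, ∀ x : ι → ℝ, F (x ∘ σ) = F x) {v : ι → ℝ}
    (hdiff : DifferentiableAt ℝ F v) (σ : Equiv.Perm ι) (hv : v ∘ σ = v) (x : ι → ℝ) :
    fderiv ℝ F v (x ∘ σ) = fderiv ℝ F v x := by
  have hd : HasDerivAt (fun t : ℝ => F (v + t • x)) (fderiv ℝ F v x) 0 :=
    hdiff.hasFDerivAt.hasLineDerivAt x
  have hd' : HasDerivAt (fun t : ℝ => F (v + t • (x ∘ σ))) (fderiv ℝ F v (x ∘ σ)) 0 :=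
    hdiff.hasFDerivAt.hasLineDerivAt (x ∘ σ)
  refine hd'.unique (hd.congr_of_eventuallyEq (Filter.Eventually.of_forall fun t => ?_))
  have h : v + t • (x ∘ σ) = (v + t • x) ∘ σ := by
    conv_lhs => rw [← hv]
    rfl
  simp only [h, hsymm]

/-- A linear functional on `ℝ^ι` whose values on basis vectors agree away from `i`. -/
lemma ContinuousLinearMap.apply_eq_of_single_eq {ι : Type*} [Fintype ι] [DecidableEq ι]
    (L : (ι → ℝ) →L[ℝ] ℝ) (i : ι) (b : ℝ) (hL : ∀ j, j ≠ i → L (Pi.single j 1) = b)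
    (x : ι → ℝ) :
    L x = L (Pi.single i 1) * x i + b * ∑ j ∈ Finset.univ.erase i, x j := by
  have h : L x = ∑ j, x j * L (Pi.single j 1) := by
    conv_lhs => rw [pi_eq_sum_univ' x, map_sum]
    refine Finset.sum_congr rfl fun j _ => ?_
    rw [map_smul, smul_eq_mul]
  rw [h, ← Finset.add_sum_erase _ _ (Finset.mem_univ i), Finset.mul_sum, mul_comm (x i)]
  congr 1
  refine Finset.sum_congr rfl fun j hj => ?_
  rw [hL j (Finset.ne_of_mem_erase hj), mul_comm]

/-- **Lemma (computation of `p_Γ`).**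
If `F` is homogeneous of degree one, symmetric, concave, differentiable at
`v = (-(n-1)/(p-1), 1, …, 1)` with `F(v) = 0` and `∂F/∂λ₁(v) > 0`, then the cone
`Γ = {F ≥ 0}` is contained in `𝒜^{(p)}`, is not contained in `𝒜^{(q)}` for any `q > p`,
and hence `p = max {q : Γ ⊆ 𝒜^{(q)}}`. -/
theorem pGamma_eq_of_boundary_ray (n : ℕ) (hn : 2 ≤ n) (p : ℝ)
    (hp1 : 1 < p) (hpn : p ≤ (n : ℝ))
    (F : (Fin n → ℝ) → ℝ)
    (hhom : ∀ t : ℝ, 0 < t → ∀ lam : Fin n → ℝ, F (t • lam) = t * F lam)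
    (hsymm : ∀ σ : Equiv.Perm (Fin n), ∀ lam : Fin n → ℝ, F (lam ∘ σ) = F lam)
    (hconc : ConcaveOn ℝ Set.univ F)
    (hdiff : DifferentiableAt ℝ F
      (fun i : Fin n => if (i : ℕ) = 0 then -(((n : ℝ) - 1) / (p - 1)) else 1))
    (hF0 : F (fun i : Fin n => if (i : ℕ) = 0 then -(((n : ℝ) - 1) / (p - 1)) else 1) = 0)
    (hder : 0 < fderiv ℝ F
      (fun i : Fin n => if (i : ℕ) = 0 then -(((n : ℝ) - 1) / (p - 1)) else 1)
      (fun i : Fin n => if (i : ℕ) = 0 then 1 else 0)) :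
    {lam | 0 ≤ F lam} ⊆ Acone n p ∧
    (∀ q : ℝ, p < q → ¬ {lam | 0 ≤ F lam} ⊆ Acone n q) ∧
    IsGreatest {q : ℝ | {lam | 0 ≤ F lam} ⊆ Acone n q} p := by
  set v : Fin n → ℝ := fun i => if (i : ℕ) = 0 then -(((n : ℝ) - 1) / (p - 1)) else 1 with hv
  have hp : 0 < p - 1 := by linarith
  have hn1 : (0 : ℝ) < n - 1 := by
    have : (2 : ℝ) ≤ n := by exact_mod_cast hn
    linarith
  let o : Fin n := ⟨0, by omega⟩
  let e : Fin n := ⟨1, by omega⟩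
  have hval (i : Fin n) : (i : ℕ) = 0 ↔ i = o := by simp [o, Fin.ext_iff]
  have hvo : v o = -(((n : ℝ) - 1) / (p - 1)) := by simp [hv, o]
  have hvne (i : Fin n) (hi : i ≠ o) : v i = 1 := by simp [hv, hval, hi]
  have hvsum : ∑ j ∈ Finset.univ.erase o, v j = (n : ℝ) - 1 := by
    rw [Finset.sum_congr rfl fun j hj => hvne j (Finset.ne_of_mem_erase hj)]
    rw [Finset.sum_const, Finset.card_erase_of_mem (Finset.mem_univ o), Finset.card_univ,
      Fintype.card_fin, nsmul_eq_mul, mul_one, Nat.cast_sub (by omega), Nat.cast_one]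
  have hsingle : (fun i : Fin n => if (i : ℕ) = 0 then (1 : ℝ) else 0) = Pi.single o 1 := by
    ext i
    simp [hval, Pi.single_apply]
  rw [hsingle] at hder
  set L := fderiv ℝ F v
  have heo : e ≠ o := by simp [e, o, Fin.ext_iff]
  have hconst (j : Fin n) (hj : j ≠ o) : L (Pi.single j 1) = L (Pi.single e 1) := by
    have hfix : v ∘ Equiv.swap j e = v := by
      ext i
      by_cases hi : i = o
      · rw [Function.comp_apply, hi, Equiv.swap_apply_of_ne_of_ne hj.symm heo.symm]
      · rw [Function.comp_apply, hvne i hi, hvne]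
        rw [Equiv.swap_apply_def]
        split_ifs <;> assumption
    rw [← fderiv_comp_perm_of_symm hsymm hdiff _ hfix]
    congr 1
    ext i
    simp only [Function.comp_apply, Pi.single_apply]
    congr 1
    rw [Equiv.swap_apply_eq_iff, Equiv.swap_apply_left]
  have hform := L.apply_eq_of_single_eq o _ hconst
  have hb : L (Pi.single o 1) = (p - 1) * L (Pi.single e 1) := by
    have h := hform v
    rw [fderiv_self_eq_zero_of_posHom hhom hdiff hF0, hvo, hvsum] at h
    field_simp at h
    rw [zero_mul] at h
    have h := (mul_eq_zero.mp h.symm).resolve_left hn1.ne'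
    linarith
  have hbpos : 0 < L (Pi.single e 1) := by
    rw [hb] at hder
    exact pos_of_mul_pos_right hder hp.le
  have hsub : {lam | 0 ≤ F lam} ⊆ Acone n p := by
    intro lam (hlam : 0 ≤ F lam) i
    let σ := Equiv.swap o i
    have h1 : 0 ≤ L (lam ∘ σ) := by
      refine le_trans ?_ (hconc.le_fderiv_of_posHom hhom hdiff (lam ∘ σ))
      rwa [hsymm]
    rw [hform, hb] at h1
    have hσ : (lam ∘ σ) o = lam i := by simp [σ]
    have hsum : ∑ j ∈ Finset.univ.erase o, (lam ∘ σ) j = ∑ j ∈ Finset.univ.erase i, lam j := by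
      rw [Finset.sum_erase_eq_sub (Finset.mem_univ o), Finset.sum_erase_eq_sub (Finset.mem_univ i),
        hσ]
      congr 1
      exact Equiv.sum_comp σ lam
    rw [hσ, hsum] at h1
    refine nonneg_of_mul_nonneg_right (a := L (Pi.single e 1)) ?_ hbpos
    linarith
  have hnot (q : ℝ) (hq : p < q) : ¬ {lam | 0 ≤ F lam} ⊆ Acone n q := by
    intro h
    have hvq := h (show v ∈ {lam | 0 ≤ F lam} from hF0.ge) o
    rw [hvsum, hvo] at hvq
    have : (q - 1) * (((n : ℝ) - 1) / (p - 1)) > (p - 1) * (((n : ℝ) - 1) / (p - 1)) :=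
      mul_lt_mul_of_pos_right (by linarith) (div_pos hn1 hp)
    rw [mul_div_cancel₀ _ hp.ne'] at this
    linarith
  exact ⟨hsub, hnot, hsub, fun q hq => le_of_not_gt fun hlt => hnot q hlt hq⟩
end
end

section
/- Let n ≥ 2 and p ∈ [2,n). There is a constant C = C(n,p) such that for every nonnegative finite Radon measure μ on ℝ^n, every ξ∞ ∈ ℝ^n and every ρ > 0, ∫_{B(ξ∞, ρ/4)} W^μ_{1,p}(ξ, 2ρ) dξ ≤ C · ρ^{n − (n−p)/(p−1)} · μ(B(ξ∞, 9ρ/4))^{1/(p−1)}. -/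
open MeasureTheory Filter Metric Set
open scoped Topology ENNReal RealInnerProductSpace Classical

noncomputable section

theorem measurable_measure_ball_uncurry {E : Type*} [PseudoMetricSpace E] [SecondCountableTopology E]
    [MeasurableSpace E] [BorelSpace E] (μ : Measure E) [SFinite μ] :
    Measurable fun z : E × ℝ => μ (ball z.1 z.2) := by
  have h : MeasurableSet {w : (E × ℝ) × E | dist w.2 w.1.1 < w.1.2} :=
    (isOpen_lt (by fun_prop) (by fun_prop)).measurableSet
  exact measurable_measure_prodMk_left h

theorem measurable_measure_ball {E : Type*} [PseudoMetricSpace E] [SecondCountableTopology E]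
    [MeasurableSpace E] [BorelSpace E] (μ : Measure E) [SFinite μ] (t : ℝ) :
    Measurable fun x : E => μ (ball x t) :=
  (measurable_measure_ball_uncurry μ).comp (g := fun z : E × ℝ => μ (ball z.1 z.2))
    (f := fun x => (x, t)) measurable_prodMk_right

theorem setLIntegral_measure_ball_le {E : Type*} [NormedAddCommGroup E] [NormedSpace ℝ E]
    [FiniteDimensional ℝ E] [MeasurableSpace E] [BorelSpace E] (ν : Measure E)
    [ν.IsAddHaarMeasure] (μ : Measure E) [SFinite μ] (c : E) {r t : ℝ} (ht : 0 < t) :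
    ∫⁻ x in ball c r, μ (ball x t) ∂ν ≤
      ENNReal.ofReal (t ^ Module.finrank ℝ E) * ν (ball 0 1) * μ (ball c (t + r)) := by
  have : ProperSpace E := FiniteDimensional.proper ℝ E
  have hmeas : MeasurableSet {w : E × E | dist w.2 w.1 < t} :=
    (isOpen_lt (by fun_prop) (by fun_prop)).measurableSet
  calc ∫⁻ x in ball c r, μ (ball x t) ∂ν
      = ((ν.restrict (ball c r)).prod μ) {w : E × E | dist w.2 w.1 < t} :=
        (Measure.prod_apply hmeas).symm
    _ = ∫⁻ y, (ν.restrict (ball c r)) {x | dist y x < t} ∂μ := Measure.prod_apply_symm hmeas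
    _ ≤ ∫⁻ y, (ball c (t + r)).indicator (fun _ =>
          ENNReal.ofReal (t ^ Module.finrank ℝ E) * ν (ball 0 1)) y ∂μ := by
        refine lintegral_mono fun y => ?_
        have hball : {x | dist y x < t} = ball y t := by
          ext x; simp [dist_comm]
        rw [hball, Measure.restrict_apply measurableSet_ball]
        by_cases hy : y ∈ ball c (t + r)
        · rw [indicator_of_mem hy, ← Measure.addHaar_ball_of_pos ν y ht]
          exact measure_mono inter_subset_left
        · have hempty : ball y t ∩ ball c r = ∅ := by
            refine eq_empty_of_forall_notMem fun x hx => hy ?_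
            have hxy : dist x y < t := hx.1
            have hxc : dist x c < r := hx.2
            rw [mem_ball]
            linarith [dist_triangle y x c, dist_comm x y]
          simp [hempty]
    _ = _ := by rw [lintegral_indicator measurableSet_ball, setLIntegral_const]

theorem setLIntegral_rpow_le_measure_rpow_mul {α : Type*} [MeasurableSpace α] (ν : Measure α)
    (s : Set α) {f : α → ℝ≥0∞} (hf : AEMeasurable f (ν.restrict s)) {q : ℝ} (hq0 : 0 ≤ q)
    (hq1 : q ≤ 1) :
    ∫⁻ x in s, f x ^ q ∂ν ≤ (∫⁻ x in s, f x ∂ν) ^ q * ν s ^ (1 - q) := by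
  simpa using ENNReal.lintegral_mul_norm_pow_le (g := fun _ => 1) hf aemeasurable_const hq0
    (sub_nonneg.2 hq1) (add_sub_cancel q 1)

theorem setLIntegral_Ioo_rpow_sub_one {a r : ℝ} (ha : 0 < a) (hr : 0 ≤ r) :
    ∫⁻ t in Ioo 0 r, ENNReal.ofReal (t ^ (a - 1)) = ENNReal.ofReal (r ^ a / a) := by
  have hint : IntegrableOn (fun t : ℝ => t ^ (a - 1)) (Ioo 0 r) :=
    ((intervalIntegrable_iff_integrableOn_Ioo_of_le hr).1
      (intervalIntegral.intervalIntegrable_rpow' (by linarith)))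
  rw [← ofReal_integral_eq_lintegral_ofReal hint
    ((ae_restrict_mem measurableSet_Ioo).mono fun t ht => Real.rpow_nonneg ht.1.le _),
    ← integral_Ioc_eq_integral_Ioo, ← intervalIntegral.integral_of_le hr,
    integral_rpow (Or.inl (by linarith))]
  simp [Real.zero_rpow ha.ne']

theorem enorm_wolff_integrand (n : ℕ) (μ : Measure (Euc n)) [IsFiniteMeasure μ] {p : ℝ}
    (hp : 1 < p) (x : Euc n) {t : ℝ} (ht : 0 < t) :
    ‖((μ (ball x t)).toReal / t ^ ((n : ℝ) - p)) ^ (1 / (p - 1)) / t‖ₑ =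
      ENNReal.ofReal (t ^ (-(((n : ℝ) - p) / (p - 1)) - 1)) * μ (ball x t) ^ (1 / (p - 1)) := by
  have hq : 0 ≤ 1 / (p - 1) := one_div_nonneg.2 (by linarith)
  have hM := ENNReal.toReal_nonneg (a := μ (ball x t))
  rw [Real.enorm_eq_ofReal (by positivity), Real.div_rpow hM (by positivity), ← Real.rpow_mul ht.le,
    Real.rpow_sub_one ht.ne', Real.rpow_neg ht.le, mul_one_div,
    show ∀ A B : ℝ, A / B / t = B⁻¹ / t * A from fun A B => by ring,
    ENNReal.ofReal_mul (by positivity), ← ENNReal.ofReal_rpow_of_nonneg hM hq,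
    ENNReal.ofReal_toReal (measure_ne_top _ _)]

theorem setLIntegral_measure_ball_rpow_le (n : ℕ) (μ : Measure (Euc n)) [IsFiniteMeasure μ]
    {q : ℝ} (hq0 : 0 ≤ q) (hq1 : q ≤ 1) (ξ : Euc n) {r t : ℝ} (ht : 0 < t) :
    ∫⁻ x in ball ξ r, μ (ball x t) ^ q ≤
      ENNReal.ofReal ((t ^ n) ^ q) *
        ((volume (ball (0 : Euc n) 1) * μ (ball ξ (t + r))) ^ q *
          volume (ball ξ r) ^ (1 - q)) := by
  have hmt := measurable_measure_ball μ t
  refine (setLIntegral_rpow_le_measure_rpow_mul volume _ hmt.aemeasurable hq0 hq1).trans ?_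
  rw [← mul_assoc, ← ENNReal.ofReal_rpow_of_nonneg (by positivity) hq0,
    ← ENNReal.mul_rpow_of_nonneg _ _ hq0]
  refine mul_le_mul_left (ENNReal.rpow_le_rpow ?_ hq0) _
  simpa [mul_assoc] using setLIntegral_measure_ball_le volume μ ξ (r := r) ht

theorem setLIntegral_wolff_weight_le (n : ℕ) (μ : Measure (Euc n)) [IsFiniteMeasure μ] {p : ℝ}
    (hp : 2 ≤ p) (ξ : Euc n) {ρ : ℝ} (hρ : 0 < ρ) :
    ∫⁻ x in ball ξ (ρ / 4), ∫⁻ t in Ioo 0 (2 * ρ),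
        ENNReal.ofReal (t ^ (-(((n : ℝ) - p) / (p - 1)) - 1)) * μ (ball x t) ^ (1 / (p - 1)) ≤
      ENNReal.ofReal ((2 * ρ) ^ (p / (p - 1)) / (p / (p - 1))) *
        ((volume (ball (0 : Euc n) 1) * μ (ball ξ (9 * ρ / 4))) ^ (1 / (p - 1)) *
          volume (ball ξ (ρ / 4)) ^ (1 - 1 / (p - 1))) := by
  have hp1 : 0 < p - 1 := by linarith
  have hq0 : 0 ≤ 1 / (p - 1) := by positivity
  have hq1 : 1 / (p - 1) ≤ 1 := by rw [div_le_one hp1]; linarith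
  have hpq : 0 < p / (p - 1) := div_pos (by linarith) hp1
  have hmeas := measurable_measure_ball_uncurry μ
  have hweight : Measurable fun t : ℝ =>
      ENNReal.ofReal (t ^ (-(((n : ℝ) - p) / (p - 1)) - 1)) := by fun_prop
  rw [lintegral_lintegral_swap
    ((hweight.comp measurable_snd).mul (hmeas.pow_const _)).aemeasurable,
    ← setLIntegral_Ioo_rpow_sub_one hpq (by linarith), ← lintegral_mul_const _ (by fun_prop)]
  refine setLIntegral_mono' measurableSet_Ioo fun t ht => ?_
  have ht0 : 0 < t := ht.1
  have hmt := measurable_measure_ball μ t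
  have hexp : t ^ (p / (p - 1) - 1) =
      t ^ (-(((n : ℝ) - p) / (p - 1)) - 1) * (t ^ n) ^ (1 / (p - 1)) := by
    rw [← Real.rpow_natCast t n, ← Real.rpow_mul ht0.le, ← Real.rpow_add ht0]
    congr 1
    ring
  have hsub : ball ξ (t + ρ / 4) ⊆ ball ξ (9 * ρ / 4) := ball_subset_ball (by linarith [ht.2])
  rw [lintegral_const_mul _ (hmt.pow_const _), hexp,
    ENNReal.ofReal_mul (Real.rpow_nonneg ht0.le _), mul_assoc]
  refine mul_le_mul_right ((setLIntegral_measure_ball_rpow_le n μ hq0 hq1 ξ ht0).trans ?_) _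
  gcongr

/-- **Lemma (average of the Wolff potential over a ball).**
For `p ∈ [2, n)` there is `C = C(n,p)` such that for every finite measure `μ`, center `ξ∞`
and `ρ > 0`,
`∫_{B(ξ∞, ρ/4)} W^μ_{1,p}(ξ, 2ρ) dξ ≤ C ρ^{n - (n-p)/(p-1)} μ(B(ξ∞, 9ρ/4))^{1/(p-1)}`. -/
theorem wolff_ball_average_bound (n : ℕ) (hn : 2 ≤ n) (p : ℝ) (hp2 : 2 ≤ p) (hpn : p < n) :
    ∃ C : ℝ, 0 < C ∧
      ∀ (μ : Measure (Euc n)), IsFiniteMeasure μ →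
        ∀ (ξ : Euc n) (ρ : ℝ), 0 < ρ →
          ∫ x in Metric.ball ξ (ρ / 4), wolff n μ p x (2 * ρ) ≤
            C * ρ ^ ((n : ℝ) - ((n : ℝ) - p) / (p - 1)) *
              (μ (Metric.ball ξ (9 * ρ / 4))).toReal ^ (1 / (p - 1)) := by
  have hp1 : 0 < p - 1 := by linarith
  set V := volume (ball (0 : Euc n) 1) with hV
  have hVtop : V ≠ ⊤ := measure_ball_lt_top.ne
  have hVpos : 0 < V.toReal := ENNReal.toReal_pos (measure_ball_pos _ _ one_pos).ne' hVtop
  refine ⟨2 ^ (p / (p - 1)) / (p / (p - 1)) * V.toReal ^ (1 / (p - 1)) *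
    ((1 / 4) ^ n * V.toReal) ^ (1 - 1 / (p - 1)), by positivity, fun μ _ ξ ρ hρ => ?_⟩
  have hle : ‖∫ x in ball ξ (ρ / 4), wolff n μ p x (2 * ρ)‖ₑ ≤ _ :=
    calc _ ≤ ∫⁻ x in ball ξ (ρ / 4), ‖wolff n μ p x (2 * ρ)‖ₑ := enorm_integral_le_lintegral_enorm _
      _ ≤ ∫⁻ x in ball ξ (ρ / 4), ∫⁻ t in Ioo 0 (2 * ρ),
            ENNReal.ofReal (t ^ (-(((n : ℝ) - p) / (p - 1)) - 1)) *
              μ (ball x t) ^ (1 / (p - 1)) := by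
          refine lintegral_mono fun x => (enorm_integral_le_lintegral_enorm _).trans_eq ?_
          exact setLIntegral_congr_fun measurableSet_Ioo fun t ht =>
            enorm_wolff_integrand n μ (by linarith) x ht.1
      _ ≤ _ := setLIntegral_wolff_weight_le n μ hp2 ξ hρ
  have hq0 : 0 ≤ 1 / (p - 1) := by positivity
  have hq1 : 0 ≤ 1 - 1 / (p - 1) := by rw [sub_nonneg, div_le_one hp1]; linarith
  have hfin : ENNReal.ofReal ((2 * ρ) ^ (p / (p - 1)) / (p / (p - 1))) *
      ((V * μ (ball ξ (9 * ρ / 4))) ^ (1 / (p - 1)) *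
        volume (ball ξ (ρ / 4)) ^ (1 - 1 / (p - 1))) ≠ ⊤ :=
    ENNReal.mul_ne_top ENNReal.ofReal_ne_top (ENNReal.mul_ne_top
      (ENNReal.rpow_ne_top_of_nonneg hq0 (ENNReal.mul_ne_top hVtop (measure_ne_top _ _)))
      (ENNReal.rpow_ne_top_of_nonneg hq1 measure_ball_lt_top.ne))
  have hreal := ENNReal.toReal_mono hfin hle
  rw [toReal_enorm, ENNReal.toReal_mul, ENNReal.toReal_mul, ← ENNReal.toReal_rpow,
    ← ENNReal.toReal_rpow, ENNReal.toReal_mul, ENNReal.toReal_ofReal (by positivity),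
    Measure.addHaar_ball_of_pos volume ξ (by positivity), ENNReal.toReal_mul,
    ENNReal.toReal_ofReal (by positivity), finrank_euclideanSpace_fin, ← hV] at hreal
  refine (Real.le_norm_self _).trans (hreal.trans_eq ?_)
  have hexp : ρ ^ ((n : ℝ) - ((n : ℝ) - p) / (p - 1)) =
      ρ ^ (p / (p - 1)) * (ρ ^ n) ^ (1 - 1 / (p - 1)) := by
    rw [← Real.rpow_natCast ρ n, ← Real.rpow_mul hρ.le, ← Real.rpow_add hρ]
    congr 1
    ring
  rw [hexp, Real.mul_rpow hVpos.le ENNReal.toReal_nonneg, Real.mul_rpow zero_le_two hρ.le,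
    show (ρ / 4) ^ n * V.toReal = ρ ^ n * ((1 / 4) ^ n * V.toReal) by
      rw [div_eq_mul_one_div, mul_pow, mul_assoc],
    Real.mul_rpow (by positivity) (by positivity)]
  ring
end
end
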